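/- Let F be a field of characteristic 0 and A a unital F-algebra (not necessarily associative). Suppose b, c, d, e ∈ N_alt(A) satisfy [b,c] = 2d, [b,d] = [b,e] = [c,d] = [c,e] = [d,e] = 0 in A; the derivations D_{b,d}, D_{b,e}, D_{c,d}, D_{c,e}, D_{d,e} are identically zero as operators on A; and D_{b,c}(b) = D_{b,c}(c) = 0. Set D = −(1/3)(2 ad_d + D_{b,c}). Then for all j, k, l, m ≥ 0, writing w = L_b^j L_c^k L_d^l L_e^m(1) (the left-tapped monomial b^j c^k d^l e^m), one has L_w = Σ_{α=0}^{min(j,k)} α! · C(j,α) · C(k,α) · L_b^{j−α} L_c^{k−α} L_d^l L_e^m D^α as operators on A, where C(·,·) denotes binomial coefficients. -/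

import Mathlib

/-- The associator `(x,y,z) = (xy)z - x(yz)`. -/
def assocEl {A : Type*} [NonUnitalNonAssocRing A] (x y z : A) : A :=
  x * y * z - x * (y * z)

/-- The generalized alternative nucleus
`N_alt(A) = { s | (s,x,y) = -(x,s,y) = (x,y,s) for all x, y }`. -/
def Nalt (A : Type*) [NonUnitalNonAssocRing A] : Set A :=
  {s | ∀ x y : A, assocEl s x y = - assocEl x s y ∧ assocEl x s y = - assocEl x y s}

/-- The commutator of two linear operators. -/
def opComm {F A : Type*} [Field F] [AddCommGroup A] [Module F A]
    (f g : Module.End F A) : Module.End F A := f * g - g * f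

/-- `ad_s = R_s - L_s`. -/
def adOp (F : Type*) {A : Type*} [Field F]
    [NonUnitalNonAssocRing A] [Module F A] [SMulCommClass F A A] [IsScalarTower F A A]
    (s : A) : Module.End F A :=
  LinearMap.mulRight F s - LinearMap.mulLeft F s

/-- `D_{s,t} = [L_s,L_t] + [L_s,R_t] + [R_s,R_t]`. -/
def Dop (F : Type*) {A : Type*} [Field F]
    [NonUnitalNonAssocRing A] [Module F A] [SMulCommClass F A A] [IsScalarTower F A A]
    (s t : A) : Module.End F A :=
  opComm (LinearMap.mulLeft F s) (LinearMap.mulLeft F t)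
    + opComm (LinearMap.mulLeft F s) (LinearMap.mulRight F t)
    + opComm (LinearMap.mulRight F s) (LinearMap.mulRight F t)

/-- `(f, g, h)` is a ternary derivation: `f (x y) = g(x) y + x h(y)`. -/
def IsTernaryDer {F A : Type*} [Field F] [NonUnitalNonAssocRing A] [Module F A]
    (f g h : Module.End F A) : Prop :=
  ∀ x y : A, f (x * y) = g x * y + x * h y

section Operators

variable {F A : Type*} [Field F] [NonUnitalNonAssocRing A] [Module F A]

theorem IsTernaryDer.add {f g h f' g' h' : Module.End F A}
    (H : IsTernaryDer f g h) (H' : IsTernaryDer f' g' h') :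
    IsTernaryDer (f + f') (g + g') (h + h') := by
  intro x y
  simp only [LinearMap.add_apply, H x y, H' x y, add_mul, mul_add]
  abel

theorem IsTernaryDer.opComm {f g h f' g' h' : Module.End F A}
    (H : IsTernaryDer f g h) (H' : IsTernaryDer f' g' h') :
    IsTernaryDer (opComm f f') (opComm g g') (opComm h h') := by
  intro x y
  simp only [_root_.opComm, LinearMap.sub_apply, Module.End.mul_apply, H x y, H' x y, map_add,
    H (g' x) y, H x (h' y), H' (g x) y, H' x (h y), sub_mul, mul_sub]
  abel

open LinearMap (mulLeft mulRight)

theorem IsTernaryDer.commute_mulLeft [SMulCommClass F A A] {f : Module.End F A}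
    (hf : IsTernaryDer f f f) {s : A} (hs : f s = 0) : Commute f (mulLeft F s) := by
  ext x
  simp [hf s x, hs]

theorem IsTernaryDer.commute_mulRight [IsScalarTower F A A] {f : Module.End F A}
    (hf : IsTernaryDer f f f) {s : A} (hs : f s = 0) : Commute f (mulRight F s) := by
  ext x
  simp [hf x s, hs]

variable [SMulCommClass F A A] [IsScalarTower F A A]

theorem isTernaryDer_mulLeft {s : A} (hs : s ∈ Nalt A) :
    IsTernaryDer (mulLeft F s) (mulLeft F s + mulRight F s) (-mulLeft F s) := by
  intro x y
  have h := (hs x y).1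
  simp only [assocEl] at h
  simp only [LinearMap.add_apply, LinearMap.neg_apply, LinearMap.mulLeft_apply,
    LinearMap.mulRight_apply, add_mul, mul_neg]
  rw [← sub_eq_zero] at h ⊢
  rw [← neg_eq_zero, ← h]
  abel

theorem isTernaryDer_mulRight {s : A} (hs : s ∈ Nalt A) :
    IsTernaryDer (mulRight F s) (-mulRight F s) (mulLeft F s + mulRight F s) := by
  intro x y
  have h := (hs x y).2
  simp only [assocEl] at h
  simp only [LinearMap.add_apply, LinearMap.neg_apply, LinearMap.mulLeft_apply,
    LinearMap.mulRight_apply, mul_add, neg_mul]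
  rw [← sub_eq_zero] at h ⊢
  rw [← h]
  abel

theorem opComm_mulRight_mulLeft {s t : A} (hs : s ∈ Nalt A) (ht : t ∈ Nalt A) :
    opComm (mulRight F s) (mulLeft F t) = opComm (mulLeft F s) (mulRight F t) := by
  ext x
  have h1 := (hs x t).1
  have h2 := (hs x t).2
  have h3 := (ht x s).1
  simp only [assocEl] at h1 h2 h3
  simp only [opComm, LinearMap.sub_apply, Module.End.mul_apply, LinearMap.mulLeft_apply,
    LinearMap.mulRight_apply]
  rw [h2, neg_neg] at h1
  rw [h3, ← neg_sub (s * x * t), h1]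

theorem opComm_mulLeft_mulLeft {s t : A} (hs : s ∈ Nalt A) (ht : t ∈ Nalt A) :
    opComm (mulLeft F s) (mulLeft F t) =
      mulLeft F (s * t - t * s) - (2 : ℕ) • opComm (mulLeft F s) (mulRight F t) := by
  rw [← opComm_mulRight_mulLeft hs ht]
  ext x
  have h1 := (ht s x).1
  have h2 := (hs t x).1
  have h3 := (hs t x).2
  simp only [assocEl] at h1 h2 h3
  simp only [opComm, LinearMap.sub_apply, Module.End.mul_apply, LinearMap.mulLeft_apply,
    LinearMap.mulRight_apply, LinearMap.add_apply, two_smul, sub_mul]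
  rw [h3, neg_neg] at h2
  rw [← h2, sub_eq_iff_eq_add.mp h1]
  abel

theorem opComm_mulRight_mulRight {s t : A} (hs : s ∈ Nalt A) (ht : t ∈ Nalt A) :
    opComm (mulRight F s) (mulRight F t) =
      -mulRight F (s * t - t * s) - (2 : ℕ) • opComm (mulLeft F s) (mulRight F t) := by
  rw [← opComm_mulRight_mulLeft hs ht]
  ext x
  have h1 := (ht x s).1
  have h2 := (ht x s).2
  have h3 := (hs x t).2
  simp only [assocEl] at h1 h2 h3
  simp only [opComm, LinearMap.sub_apply, Module.End.mul_apply, LinearMap.mulLeft_apply,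
    LinearMap.mulRight_apply, LinearMap.add_apply, LinearMap.neg_apply, two_smul, mul_sub]
  rw [h1, ← sub_eq_zero]
  rw [← sub_eq_zero] at h2
  rw [← neg_eq_zero, ← h2]
  abel

theorem isTernaryDer_Dop {s t : A} (hs : s ∈ Nalt A) (ht : t ∈ Nalt A) :
    IsTernaryDer (Dop F s t) (Dop F s t) (Dop F s t) := by
  have key := opComm_mulRight_mulLeft (F := F) hs ht
  have h := (((isTernaryDer_mulLeft (F := F) hs).opComm (isTernaryDer_mulLeft (F := F) ht)).add
    ((isTernaryDer_mulLeft (F := F) hs).opComm (isTernaryDer_mulRight (F := F) ht))).add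
    ((isTernaryDer_mulRight (F := F) hs).opComm (isTernaryDer_mulRight (F := F) ht))
  simp only [opComm] at key h
  rw [← sub_eq_zero, ← neg_eq_zero] at key
  convert h using 1 <;> rw [Dop] <;> simp only [opComm] <;> rw [← sub_eq_zero, ← key] <;>
    noncomm_ring

theorem Dop_eq {s t : A} (hs : s ∈ Nalt A) (ht : t ∈ Nalt A) :
    Dop F s t =
      -adOp F (s * t - t * s) - (3 : ℕ) • opComm (mulLeft F s) (mulRight F t) := by
  rw [Dop, opComm_mulLeft_mulLeft hs ht, opComm_mulRight_mulRight hs ht, adOp]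
  abel

theorem commute_of_Dop_eq_zero [CharZero F] {s t : A} (hs : s ∈ Nalt A) (ht : t ∈ Nalt A)
    (hst : s * t = t * s) (hD : Dop F s t = 0) :
    Commute (mulLeft F s) (mulLeft F t) ∧ Commute (mulLeft F s) (mulRight F t) ∧
      Commute (mulRight F s) (mulLeft F t) ∧ Commute (mulRight F s) (mulRight F t) := by
  have h0 : opComm (mulLeft F s) (mulRight F t) = 0 := by
    have h := Dop_eq (F := F) hs ht
    rw [hD, hst, sub_self] at h
    have h3 : (3 : F) • opComm (mulLeft F s) (mulRight F t) = 0 := by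
      simpa [adOp, ← Nat.cast_smul_eq_nsmul F] using h
    exact (smul_eq_zero.mp h3).resolve_left three_ne_zero
  have hLL := opComm_mulLeft_mulLeft (F := F) hs ht
  have hRR := opComm_mulRight_mulRight (F := F) hs ht
  have hRL := opComm_mulRight_mulLeft (F := F) hs ht
  rw [h0] at hRL
  rw [hst, sub_self, h0] at hLL hRR
  exact ⟨sub_eq_zero.mp (hLL.trans (by simp)), sub_eq_zero.mp h0, sub_eq_zero.mp hRL,
    sub_eq_zero.mp (hRR.trans (by simp))⟩

theorem commute_mulRight_mulLeft_self {s : A} (hs : s ∈ Nalt A) [CharZero F] :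
    Commute (mulRight F s) (mulLeft F s) := by
  have h2 : (2 : F) • opComm (mulRight F s) (mulLeft F s) = 0 := by
    have h := opComm_mulRight_mulLeft (F := F) hs hs
    rw [two_smul]
    nth_rewrite 1 [h]
    simp [opComm]
  exact sub_eq_zero.mp ((smul_eq_zero.mp h2).resolve_left two_ne_zero)

theorem mulLeft_mul_of_mem_Nalt {s : A} (hs : s ∈ Nalt A) (x : A) :
    mulLeft F (s * x) =
      mulLeft F s * mulLeft F x + (mulRight F s * mulLeft F x - mulLeft F x * mulRight F s) := by
  ext y
  have h1 := (hs x y).1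
  have h2 := (hs x y).2
  simp only [assocEl] at h1 h2
  simp only [LinearMap.add_apply, LinearMap.sub_apply, Module.End.mul_apply,
    LinearMap.mulLeft_apply, LinearMap.mulRight_apply]
  rw [h2, neg_neg] at h1
  rw [← h1]
  abel

theorem mulLeft_pow_apply_of_commute {s x : A} (hs : s ∈ Nalt A) [CharZero F]
    (hx : Commute (mulRight F s) (mulLeft F x)) (n : ℕ) :
    mulLeft F ((mulLeft F s ^ n) x) = mulLeft F s ^ n * mulLeft F x := by
  induction n with
  | zero => simp
  | succ n ih =>
    have hc : Commute (mulRight F s) (mulLeft F s ^ n * mulLeft F x) :=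
      ((commute_mulRight_mulLeft_self hs).pow_right n).mul_right hx
    rw [pow_succ', Module.End.mul_apply, LinearMap.mulLeft_apply, mulLeft_mul_of_mem_Nalt hs, ih,
      hc.eq, sub_self, add_zero, mul_assoc]

end Operators

section RingIdentities

variable {R : Type*} [Ring R]

theorem mul_pow_eq_of_commutator {P C D : R} (hPC : P * C - C * P = D) (hDC : Commute D C)
    (n : ℕ) : P * C ^ n = C ^ n * P + n • (C ^ (n - 1) * D) := by
  have hPC' : P * C = C * P + D := by rw [← hPC]; abel
  induction n with
  | zero => simp
  | succ n ih =>
    have hn : n • (C ^ (n - 1) * (D * C)) = n • (C ^ n * D) := by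
      cases n with
      | zero => simp
      | succ n => rw [hDC.eq, ← mul_assoc, Nat.add_sub_cancel, ← pow_succ]
    rw [pow_succ, ← mul_assoc, ih, add_mul, mul_assoc, hPC', smul_mul_assoc, mul_assoc, hn,
      Nat.add_sub_cancel, mul_add, succ_nsmul]
    noncomm_ring

theorem mul_monomial_sub_monomial_mul {P B C W D : R} (hPB : Commute P B)
    (hPC : P * C - C * P = D) (hPW : Commute P W) (hPD : Commute P D)
    (hDC : Commute D C) (hDW : Commute D W) (a n α : ℕ) :
    P * (B ^ a * C ^ n * W * D ^ α) - B ^ a * C ^ n * W * D ^ α * P =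
      n • (B ^ a * C ^ (n - 1) * W * D ^ (α + 1)) := by
  have h1 : P * (B ^ a * C ^ n * W * D ^ α) =
      B ^ a * (P * C ^ n) * W * D ^ α := by
    simp only [← mul_assoc]
    rw [(hPB.pow_right a).eq]
  have h2 : B ^ a * C ^ n * W * D ^ α * P = B ^ a * (C ^ n * P) * W * D ^ α := by
    rw [mul_assoc _ (D ^ α) P, ← (hPD.pow_right α).eq, ← mul_assoc, mul_assoc _ W P, ← hPW.eq]
    simp only [mul_assoc]
  have h3 : B ^ a * (C ^ (n - 1) * D) * W * D ^ α = B ^ a * C ^ (n - 1) * W * D ^ (α + 1) := by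
    rw [pow_succ', ← mul_assoc _ D, mul_assoc _ W D, ← hDW.eq]
    simp only [mul_assoc]
  rw [h1, h2, mul_pow_eq_of_commutator hPC hDC, mul_add, add_mul, add_mul, add_sub_cancel_left,
    mul_smul_comm, smul_mul_assoc, smul_mul_assoc, h3]

/-- The normally ordered sum `Σ_α α! C(j,α) C(k,α) B^{j-α} C^{k-α} W D^α`. -/
def normalSum (B C W D : R) (j k : ℕ) : R :=
  ∑ α ∈ Finset.range (k + 1), (α.factorial * j.choose α * k.choose α) •
    (B ^ (j - α) * C ^ (k - α) * W * D ^ α)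

theorem normalSum_zero (B C W D : R) (k : ℕ) : normalSum B C W D 0 k = C ^ k * W := by
  rw [normalSum, Finset.sum_range_succ']
  simp

theorem normalSum_eq_sum_range_min (B C W D : R) (j k : ℕ) :
    normalSum B C W D j k = ∑ α ∈ Finset.range (min j k + 1),
      (α.factorial * j.choose α * k.choose α) • (B ^ (j - α) * C ^ (k - α) * W * D ^ α) := by
  refine (Finset.sum_subset (Finset.range_mono (by omega)) fun α hα hα' => ?_).symm
  rw [Finset.mem_range] at hα hα'
  rw [Nat.choose_eq_zero_of_lt (show j < α by omega)]
  simp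

theorem normalSum_succ {P B C W D : R} (hPB : Commute P B)
    (hPC : P * C - C * P = D) (hPW : Commute P W) (hPD : Commute P D)
    (hDC : Commute D C) (hDW : Commute D W) (j k : ℕ) :
    normalSum B C W D (j + 1) k = B * normalSum B C W D j k +
      (P * normalSum B C W D j k - normalSum B C W D j k * P) := by
  have hB : B * normalSum B C W D j k = ∑ α ∈ Finset.range (k + 1),
      (α.factorial * j.choose α * k.choose α) •
        (B ^ (j + 1 - α) * C ^ (k - α) * W * D ^ α) := by
    rw [normalSum, Finset.mul_sum]
    refine Finset.sum_congr rfl fun α _ => ?_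
    rcases le_or_gt α j with h | h
    · rw [mul_smul_comm, Nat.sub_add_comm h, pow_succ']
      simp only [mul_assoc]
    · rw [Nat.choose_eq_zero_of_lt h]
      simp
  have hP : P * normalSum B C W D j k - normalSum B C W D j k * P =
      ∑ α ∈ Finset.range k, ((α + 1).factorial * j.choose α * k.choose (α + 1)) •
        (B ^ (j - α) * C ^ (k - (α + 1)) * W * D ^ (α + 1)) := by
    rw [normalSum, Finset.mul_sum, Finset.sum_mul, ← Finset.sum_sub_distrib]
    simp only [mul_smul_comm, smul_mul_assoc, ← smul_sub,
      mul_monomial_sub_monomial_mul hPB hPC hPW hPD hDC hDW]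
    rw [Finset.sum_range_succ, Nat.sub_self, zero_smul, smul_zero, add_zero]
    refine Finset.sum_congr rfl fun α _ => ?_
    rw [smul_smul, Nat.sub_sub]
    congr 1
    rw [mul_assoc, ← Nat.choose_succ_right_eq, Nat.factorial_succ]
    ring
  rw [hB, hP, normalSum, Finset.sum_range_succ', Finset.sum_range_succ' _ k, add_right_comm,
    ← Finset.sum_add_distrib]
  congr 1
  · refine Finset.sum_congr rfl fun α _ => ?_
    rw [Nat.add_sub_add_right, ← add_smul, Nat.choose_succ_succ']
    congr 1
    ring
  · simp

end RingIdentities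

/-- under the stated hypotheses on `b, c, d, e ∈ N_alt(A)`, with
`D = -(1/3)(2 ad_d + D_{b,c})`, the operator of left multiplication by the
left-tapped monomial `b^j c^k d^l e^m = L_b^j L_c^k L_d^l L_e^m (1)` equals
`Σ_{α=0}^{min(j,k)} α! C(j,α) C(k,α) L_b^{j-α} L_c^{k-α} L_d^l L_e^m D^α`. -/
theorem left_mul_of_bcde_monomials
    (F A : Type*) [Field F] [CharZero F]
    [NonAssocRing A] [Module F A] [SMulCommClass F A A] [IsScalarTower F A A]
    (b c d e : A)
    (hb : b ∈ Nalt A) (hc : c ∈ Nalt A) (hd : d ∈ Nalt A) (he : e ∈ Nalt A)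
    (hbc : b * c - c * b = (2 : F) • d)
    (hbd : b * d = d * b) (hbe : b * e = e * b) (hcd : c * d = d * c)
    (hce : c * e = e * c) (hde : d * e = e * d)
    (hDbd : Dop F b d = 0) (hDbe : Dop F b e = 0) (hDcd : Dop F c d = 0)
    (hDce : Dop F c e = 0) (hDde : Dop F d e = 0)
    (hDbcb : Dop F b c b = 0) (hDbcc : Dop F b c c = 0) :
    ∀ j k l m : ℕ,
      LinearMap.mulLeft F
          (((LinearMap.mulLeft F b) ^ j * (LinearMap.mulLeft F c) ^ k *
              (LinearMap.mulLeft F d) ^ l * (LinearMap.mulLeft F e) ^ m) (1 : A)) =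
        ∑ α ∈ Finset.range (min j k + 1),
          (Nat.factorial α * Nat.choose j α * Nat.choose k α) •
            ((LinearMap.mulLeft F b) ^ (j - α) * (LinearMap.mulLeft F c) ^ (k - α) *
              (LinearMap.mulLeft F d) ^ l * (LinearMap.mulLeft F e) ^ m *
              (-(1/3 : F) • ((2 : F) • adOp F d + Dop F b c)) ^ α) := by
  intro j k l m
  obtain ⟨hbdLL, hbdLR, hbdRL, hbdRR⟩ := commute_of_Dop_eq_zero hb hd hbd hDbd
  obtain ⟨hbeLL, -, hbeRL, -⟩ := commute_of_Dop_eq_zero hb he hbe hDbe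
  obtain ⟨hcdLL, hcdLR, hcdRL, -⟩ := commute_of_Dop_eq_zero hc hd hcd hDcd
  obtain ⟨-, -, hceRL, -⟩ := commute_of_Dop_eq_zero hc he hce hDce
  obtain ⟨-, -, hdeRL, -⟩ := commute_of_Dop_eq_zero hd he hde hDde
  have hD : -(1/3 : F) • ((2 : F) • adOp F d + Dop F b c) =
      opComm (LinearMap.mulLeft F b) (LinearMap.mulRight F c) := by
    have had : adOp F ((2 : F) • d) = (2 : F) • adOp F d := by
      ext x
      simp only [adOp, LinearMap.sub_apply, LinearMap.smul_apply, LinearMap.mulLeft_apply,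
        LinearMap.mulRight_apply, mul_smul_comm, smul_mul_assoc, smul_sub]
    rw [Dop_eq hb hc, hbc, had, ← Nat.cast_smul_eq_nsmul F]
    module
  set D := -(1/3 : F) • ((2 : F) • adOp F d + Dop F b c) with hDdef
  have hder := isTernaryDer_Dop (F := F) hb hc
  have hDLc : Commute D (LinearMap.mulLeft F c) :=
    ((((hcdLR.symm.sub_left hcdLL.symm).smul_left (2 : F)).add_left
      (hder.commute_mulLeft hDbcc)).smul_left _)
  have hDRb : Commute D (LinearMap.mulRight F b) :=
    ((((hbdRR.symm.sub_left hbdRL.symm).smul_left (2 : F)).add_left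
      (hder.commute_mulRight hDbcb)).smul_left _)
  have comm_D : ∀ {T : Module.End F A}, Commute (LinearMap.mulLeft F b) T →
      Commute (LinearMap.mulRight F c) T → Commute D T := fun h h' => by
    rw [hD]
    exact (h.mul_left h').sub_left (h'.mul_left h)
  have hbc' : LinearMap.mulRight F b * LinearMap.mulLeft F c -
      LinearMap.mulLeft F c * LinearMap.mulRight F b = D := by
    rw [hD]
    exact opComm_mulRight_mulLeft hb hc
  have hW (T : Module.End F A) (h : Commute T (LinearMap.mulLeft F d))
      (h' : Commute T (LinearMap.mulLeft F e)) :
      Commute T (LinearMap.mulLeft F d ^ l * LinearMap.mulLeft F e ^ m) :=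
    (h.pow_right l).mul_right (h'.pow_right m)
  have hone : LinearMap.mulLeft F (1 : A) = 1 := LinearMap.mulLeft_one F A
  have hLe : LinearMap.mulLeft F ((LinearMap.mulLeft F e ^ m) 1) = LinearMap.mulLeft F e ^ m := by
    rw [mulLeft_pow_apply_of_commute he (hone.symm ▸ Commute.one_right _), hone, mul_one]
  have hLde : LinearMap.mulLeft F ((LinearMap.mulLeft F d ^ l) ((LinearMap.mulLeft F e ^ m) 1)) =
      LinearMap.mulLeft F d ^ l * LinearMap.mulLeft F e ^ m := by
    rw [mulLeft_pow_apply_of_commute hd (hLe.symm ▸ hdeRL.pow_right m), hLe]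
  have hLcde : LinearMap.mulLeft F ((LinearMap.mulLeft F c ^ k)
        ((LinearMap.mulLeft F d ^ l) ((LinearMap.mulLeft F e ^ m) 1))) =
      LinearMap.mulLeft F c ^ k * (LinearMap.mulLeft F d ^ l * LinearMap.mulLeft F e ^ m) := by
    rw [mulLeft_pow_apply_of_commute hc (hLde.symm ▸ hW _ hcdRL hceRL), hLde]
  have hsum : LinearMap.mulLeft F ((LinearMap.mulLeft F b ^ j) ((LinearMap.mulLeft F c ^ k)
        ((LinearMap.mulLeft F d ^ l) ((LinearMap.mulLeft F e ^ m) 1)))) =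
      normalSum (LinearMap.mulLeft F b) (LinearMap.mulLeft F c)
        (LinearMap.mulLeft F d ^ l * LinearMap.mulLeft F e ^ m) D j k := by
    induction j with
    | zero => rw [normalSum_zero, pow_zero, Module.End.one_apply, hLcde]
    | succ j ih =>
      rw [pow_succ', Module.End.mul_apply, LinearMap.mulLeft_apply, mulLeft_mul_of_mem_Nalt hb, ih,
        normalSum_succ (commute_mulRight_mulLeft_self hb) hbc' (hW _ hbdRL hbeRL) hDRb.symm hDLc
          (hW _ (comm_D hbdLL hcdRL) (comm_D hbeLL hceRL))]
  simp only [Module.End.mul_apply]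
  rw [hsum, normalSum_eq_sum_range_min]
  simp only [mul_assoc]
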